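/- arXiv:1703.04058 — 4 statements merged into one kernel-verified Lean document; each statement's English description precedes it below -/
import Mathlib

section
/- Let p ≥ 1 and let γ : ℝ → ℝ^p be a smooth curve with ‖γ'(t)‖ = 1 for all t in an open interval containing 0. Then, as t → 0⁺, ‖γ(t) − γ(0)‖ = t − (1/24)·‖γ''(0)‖²·t³ − (1/24)·(γ'''(0)·γ''(0))·t⁴ − ((1/80)·γ⁽⁴⁾(0)·γ''(0) + (1/90)·‖γ'''(0)‖² + (1/1152)·‖γ''(0)‖⁴)·t⁵ + O(t⁶). -/
open Asymptotics Filter Topology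
open scoped RealInnerProductSpace

theorem sub_taylorWithinEval_univ_isBigO {E : Type*} [NormedAddCommGroup E]
    [NormedSpace ℝ E] {f : ℝ → E} {x₀ : ℝ} {n : ℕ}
    (hf : ContDiff ℝ (n + 1 : ℕ) f) :
    (fun x => f x - taylorWithinEval f n Set.univ x₀ x) =O[𝓝 x₀]
      fun x => (x - x₀) ^ (n + 1) := by
  have h := (taylor_isLittleO_univ (x₀ := x₀) hf).isBigO
  simp only [taylorWithinEval_succ] at h
  have h' : (fun x => (((n + 1 : ℝ) * n.factorial)⁻¹ * (x - x₀) ^ (n + 1)) •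
      iteratedDerivWithin (n + 1) f Set.univ x₀) =O[𝓝 x₀] fun x => (x - x₀) ^ (n + 1) := by
    refine IsBigO.of_bound
      (‖((n + 1 : ℝ) * n.factorial)⁻¹‖ * ‖iteratedDerivWithin (n + 1) f Set.univ x₀‖)
      (Eventually.of_forall fun x => le_of_eq ?_)
    rw [norm_smul, norm_mul]
    ring
  refine (h.add h').congr_left fun x => ?_
  abel

theorem hasDerivAt_iteratedDeriv {E : Type*} [NormedAddCommGroup E] [NormedSpace ℝ E]
    {f : ℝ → E} (hf : ContDiff ℝ (⊤ : ℕ∞) f) (k : ℕ) (t : ℝ) :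
    HasDerivAt (iteratedDeriv k f) (iteratedDeriv (k + 1) f t) t := by
  rw [iteratedDeriv_succ]
  exact (hf.differentiable_iteratedDeriv k
    (by exact_mod_cast WithTop.coe_lt_top k) t).hasDerivAt

theorem norm_sub_isBigO_of_sq {α E : Type*} [SeminormedAddCommGroup E] {q : α → E}
    {r g : α → ℝ} {l : Filter α} {c : ℝ} (hc : 0 < c) (hr : Tendsto r l (𝓝 c))
    (h : (fun t => ‖q t‖ ^ 2 - r t ^ 2) =O[l] g) :
    (fun t => ‖q t‖ - r t) =O[l] g := by
  refine IsBigO.trans (IsBigO.of_bound (2 / c) ?_) h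
  filter_upwards [hr.eventually_const_lt (half_lt_self hc)] with t ht
  have hsum : c / 2 ≤ ‖q t‖ + r t := by linarith [norm_nonneg (q t)]
  have hfac : ‖q t‖ ^ 2 - r t ^ 2 = (‖q t‖ + r t) * (‖q t‖ - r t) := by ring
  rw [hfac, norm_mul, Real.norm_of_nonneg (by linarith : 0 ≤ ‖q t‖ + r t), ← mul_assoc]
  refine le_mul_of_one_le_left (norm_nonneg _) ?_
  calc (1 : ℝ) = 2 / c * (c / 2) := by field_simp
    _ ≤ 2 / c * (‖q t‖ + r t) := by gcongr

section UnitSpeed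

variable {E : Type*} [NormedAddCommGroup E] [InnerProductSpace ℝ E]

theorem hasDerivAt_inner_iteratedDeriv {f : ℝ → E} (hf : ContDiff ℝ (⊤ : ℕ∞) f)
    (j k : ℕ) (t : ℝ) :
    HasDerivAt (fun s => ⟪iteratedDeriv j f s, iteratedDeriv k f s⟫)
      (⟪iteratedDeriv j f t, iteratedDeriv (k + 1) f t⟫ +
        ⟪iteratedDeriv (j + 1) f t, iteratedDeriv k f t⟫) t :=
  (hasDerivAt_iteratedDeriv hf j t).inner ℝ (hasDerivAt_iteratedDeriv hf k t)

theorem eventually_deriv_eq_zero_of_eventually_const {g g' : ℝ → ℝ} {x c : ℝ}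
    (hg : ∀ t, HasDerivAt g (g' t) t) (h : ∀ᶠ t in 𝓝 x, g t = c) :
    ∀ᶠ t in 𝓝 x, g' t = 0 := by
  filter_upwards [h.eventually_nhds] with t ht
  exact (hg t).unique ((hasDerivAt_const t c).congr_of_eventuallyEq ht)

/-- Inner products of the velocity with the higher derivatives of a unit-speed curve. -/
theorem inner_iteratedDeriv_of_unit_speed {f : ℝ → E} (hf : ContDiff ℝ (⊤ : ℕ∞) f) {x : ℝ}
    (h : ∀ᶠ t in 𝓝 x, ‖deriv f t‖ = 1) :
    ⟪iteratedDeriv 1 f x, iteratedDeriv 1 f x⟫ = 1 ∧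
    ⟪iteratedDeriv 1 f x, iteratedDeriv 2 f x⟫ = 0 ∧
    ⟪iteratedDeriv 1 f x, iteratedDeriv 3 f x⟫ =
      -⟪iteratedDeriv 2 f x, iteratedDeriv 2 f x⟫ ∧
    ⟪iteratedDeriv 1 f x, iteratedDeriv 4 f x⟫ =
      -3 * ⟪iteratedDeriv 2 f x, iteratedDeriv 3 f x⟫ ∧
    ⟪iteratedDeriv 1 f x, iteratedDeriv 5 f x⟫ =
      -4 * ⟪iteratedDeriv 2 f x, iteratedDeriv 4 f x⟫ -
        3 * ⟪iteratedDeriv 3 f x, iteratedDeriv 3 f x⟫ := by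
  have D := hasDerivAt_inner_iteratedDeriv hf
  have h₁ : ∀ᶠ t in 𝓝 x, ⟪iteratedDeriv 1 f t, iteratedDeriv 1 f t⟫ = 1 := by
    filter_upwards [h] with t ht
    rw [real_inner_self_eq_norm_sq, iteratedDeriv_one, ht, one_pow]
  have h₂ : ∀ᶠ t in 𝓝 x, ⟪iteratedDeriv 1 f t, iteratedDeriv 2 f t⟫ = 0 := by
    filter_upwards [eventually_deriv_eq_zero_of_eventually_const (D 1 1) h₁] with t ht
    simp only [Nat.reduceAdd] at ht
    linarith [real_inner_comm (iteratedDeriv 1 f t) (iteratedDeriv 2 f t)]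
  have h₃ := eventually_deriv_eq_zero_of_eventually_const (D 1 2) h₂
  have h₄ := eventually_deriv_eq_zero_of_eventually_const
    (fun t => (D 1 3 t).add (D 2 2 t)) h₃
  have h₅ := eventually_deriv_eq_zero_of_eventually_const
    (fun t => ((D 1 4 t).add (D 2 3 t)).add ((D 2 3 t).add (D 3 2 t))) h₄
  have e₃ := h₃.self_of_nhds
  have e₄ := h₄.self_of_nhds
  have e₅ := h₅.self_of_nhds
  simp only [Nat.reduceAdd] at e₃ e₄ e₅
  have c₂₃ := real_inner_comm (iteratedDeriv 2 f x) (iteratedDeriv 3 f x)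
  have c₂₄ := real_inner_comm (iteratedDeriv 2 f x) (iteratedDeriv 4 f x)
  exact ⟨h₁.self_of_nhds, h₂.self_of_nhds, by linarith, by linarith, by linarith⟩

/-- If `v₁, …, v₅` satisfy the relations between the derivatives of a unit-speed curve, the
norm of the Taylor polynomial divided by `t` has the expected expansion. -/
theorem norm_taylor_quotient_isBigO {v₁ v₂ v₃ v₄ v₅ : E}
    (h₁ : ⟪v₁, v₁⟫ = 1) (h₂ : ⟪v₁, v₂⟫ = 0) (h₃ : ⟪v₁, v₃⟫ = -⟪v₂, v₂⟫)
    (h₄ : ⟪v₁, v₄⟫ = -3 * ⟪v₂, v₃⟫) (h₅ : ⟪v₁, v₅⟫ = -4 * ⟪v₂, v₄⟫ - 3 * ⟪v₃, v₃⟫) :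
    (fun t : ℝ => ‖v₁ + (t / 2) • v₂ + (t ^ 2 / 6) • v₃ + (t ^ 3 / 24) • v₄ +
        (t ^ 4 / 120) • v₅‖ -
      (1 - (1 / 24) * ‖v₂‖ ^ 2 * t ^ 2 - (1 / 24) * ⟪v₃, v₂⟫ * t ^ 3 -
        ((1 / 80) * ⟪v₄, v₂⟫ + (1 / 90) * ‖v₃‖ ^ 2 + (1 / 1152) * ‖v₂‖ ^ 4) * t ^ 4))
      =O[𝓝 0] fun t => t ^ 5 := by
  set K := (1 / 80) * ⟪v₄, v₂⟫ + (1 / 90) * ‖v₃‖ ^ 2 + (1 / 1152) * ‖v₂‖ ^ 4 with hK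
  refine norm_sub_isBigO_of_sq one_pos ?_ ?_
  · refine Continuous.tendsto' (by fun_prop) _ _ (by norm_num)
  let R : ℝ → ℝ := fun t =>
    (⟪v₂, v₅⟫ / 120 + ⟪v₃, v₄⟫ / 72 - ⟪v₂, v₂⟫ * ⟪v₂, v₃⟫ / 288) +
    (⟪v₃, v₅⟫ / 360 + ⟪v₄, v₄⟫ / 576 - ⟪v₂, v₃⟫ ^ 2 / 576 - ⟪v₂, v₂⟫ * K / 12) * t +
    (⟪v₄, v₅⟫ / 1440 - ⟪v₂, v₃⟫ * K / 12) * t ^ 2 +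
    (⟪v₅, v₅⟫ / 14400 - K ^ 2) * t ^ 3
  have hR : R =O[𝓝 0] (fun _ => (1 : ℝ)) :=
    (Continuous.tendsto (by fun_prop : Continuous R) 0).isBigO_one ℝ
  refine ((isBigO_refl (fun t : ℝ => t ^ 5) (𝓝 0)).mul hR).congr (fun t => ?_) fun t => mul_one _
  have hK' : K = (1 / 80) * ⟪v₂, v₄⟫ + (1 / 90) * ⟪v₃, v₃⟫ + (1 / 1152) * ⟪v₂, v₂⟫ ^ 2 := by
    rw [hK, real_inner_comm v₂ v₄, real_inner_self_eq_norm_sq, real_inner_self_eq_norm_sq]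
    ring
  simp only [R]
  clear_value K
  rw [← real_inner_self_eq_norm_sq, ← real_inner_self_eq_norm_sq]
  simp only [inner_add_left, inner_add_right, real_inner_smul_left, real_inner_smul_right]
  rw [real_inner_comm v₁ v₂, real_inner_comm v₁ v₃, real_inner_comm v₁ v₄,
    real_inner_comm v₁ v₅, real_inner_comm v₂ v₃, real_inner_comm v₂ v₄,
    real_inner_comm v₂ v₅, real_inner_comm v₃ v₄, real_inner_comm v₃ v₅,
    real_inner_comm v₄ v₅, h₁, h₂, h₃, h₄, h₅]
  linear_combination (-2 * t ^ 4) * hK'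

end UnitSpeed

/-- Fifth-order expansion of the chordal distance `‖γ(t) − γ(0)‖` of a smooth unit-speed
curve, as `t → 0⁺`. -/
theorem chordal_distance_expansion_unit_speed
    (p : ℕ) (hp : 1 ≤ p)
    (γ : ℝ → EuclideanSpace ℝ (Fin p))
    (hγ : ContDiff ℝ (⊤ : ℕ∞) γ)
    (a b : ℝ) (ha : a < 0) (hb : 0 < b)
    (hunit : ∀ t ∈ Set.Ioo a b, ‖deriv γ t‖ = 1) :
    (fun t => ‖γ t - γ 0‖ -
        (t - (1 / 24) * ‖iteratedDeriv 2 γ 0‖ ^ 2 * t ^ 3 -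
          (1 / 24) * ⟪iteratedDeriv 3 γ 0, iteratedDeriv 2 γ 0⟫ * t ^ 4 -
          ((1 / 80) * ⟪iteratedDeriv 4 γ 0, iteratedDeriv 2 γ 0⟫ +
            (1 / 90) * ‖iteratedDeriv 3 γ 0‖ ^ 2 +
            (1 / 1152) * ‖iteratedDeriv 2 γ 0‖ ^ 4) * t ^ 5))
      =O[𝓝[>] (0 : ℝ)] fun t => t ^ 6 := by
  obtain ⟨h₁, h₂, h₃, h₄, h₅⟩ := inner_iteratedDeriv_of_unit_speed (x := 0) hγ
    (eventually_of_mem (Ioo_mem_nhds ha hb) hunit)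
  have hmain := ((isBigO_refl (fun t : ℝ => t) (𝓝 0)).mul
    (norm_taylor_quotient_isBigO h₁ h₂ h₃ h₄ h₅)).mono (nhdsWithin_le_nhds (s := Set.Ioi 0))
  have htaylor := (sub_taylorWithinEval_univ_isBigO (x₀ := 0) (n := 5)
    (contDiff_infty.1 hγ _)).mono (nhdsWithin_le_nhds (s := Set.Ioi 0))
  simp only [sub_zero] at htaylor
  have hrem : (fun t => ‖γ t - γ 0‖ - t * ‖iteratedDeriv 1 γ 0 + (t / 2) • iteratedDeriv 2 γ 0 +
      (t ^ 2 / 6) • iteratedDeriv 3 γ 0 + (t ^ 3 / 24) • iteratedDeriv 4 γ 0 +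
      (t ^ 4 / 120) • iteratedDeriv 5 γ 0‖) =O[𝓝[>] (0 : ℝ)] fun t => t ^ 6 := by
    refine IsBigO.trans (IsBigO.of_bound 1 ?_) htaylor
    filter_upwards [self_mem_nhdsWithin] with t ht
    rw [one_mul, ← Real.norm_of_nonneg (le_of_lt ht), ← norm_smul,
      Real.norm_of_nonneg (le_of_lt ht)]
    refine (abs_norm_sub_norm_le _ _).trans (le_of_eq (congrArg norm ?_))
    simp only [taylor_within_apply, Finset.sum_range_succ, Finset.sum_range_zero,
      iteratedDerivWithin_univ, iteratedDeriv_zero, sub_zero, Nat.factorial]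
    module
  refine (hrem.add (hmain.congr_right fun t => (pow_succ' t 5).symm)).congr_left fun t => ?_
  ring
end

section
/- Let p ≥ 1 and let γ : ℝ → ℝ^p be a smooth curve with ‖γ'(t)‖ = 1 for all t in an open interval containing 0. For t > 0 set t̃(t) := ‖γ(t) − γ(0)‖. Then, as t → 0⁺, t = t̃(t) + (1/24)·‖γ''(0)‖²·t̃(t)³ + (1/24)·(γ'''(0)·γ''(0))·t̃(t)⁴ + ((1/80)·γ⁽⁴⁾(0)·γ''(0) + (1/90)·‖γ'''(0)‖² + (7/1152)·‖γ''(0)‖⁴)·t̃(t)⁵ + O(t⁶). -/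
open Asymptotics Filter Topology
open scoped RealInnerProductSpace

section Auxiliary

variable {E : Type*} [NormedAddCommGroup E]

/-- Taylor's theorem at the origin, with a remainder of the order of the first omitted term. -/
theorem ContDiff.sub_taylor_isBigO [NormedSpace ℝ E] {f : ℝ → E} {n : ℕ} (hf : ContDiff ℝ n f) :
    (fun t : ℝ => f t - ∑ k ∈ Finset.range n,
      ((k.factorial : ℝ)⁻¹ * t ^ k) • iteratedDeriv k f 0) =O[𝓝 0] fun t => t ^ n := by
  have h := (taylor_isLittleO_univ (x₀ := 0) hf).isBigO
  simp only [taylor_within_apply, Finset.sum_range_succ, iteratedDerivWithin_univ,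
    sub_zero] at h
  have hlast : (fun t : ℝ => ((n.factorial : ℝ)⁻¹ * t ^ n) • iteratedDeriv n f 0)
      =O[𝓝 0] fun t => t ^ n := by
    have h₁ : (fun t : ℝ => (n.factorial : ℝ)⁻¹ * t ^ n) =O[𝓝 0] fun t => t ^ n :=
      (isBigO_refl _ _).const_mul_left _
    simpa using h₁.smul (isBigO_refl (fun _ : ℝ => iteratedDeriv n f 0) (𝓝 0)) |>.trans
      (isBigO_of_le' (c := ‖iteratedDeriv n f 0‖) (g := fun t : ℝ => t ^ n) _
        fun t => by rw [norm_smul, mul_comm])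
  refine (h.add hlast).congr_left fun t => ?_
  abel

/-- Perturbing a vector of size `t` by an error of size `t ^ n`, `n ≥ 1`, changes its squared norm
by an error of size `t ^ (n + 1)`. -/
theorem Asymptotics.IsBigO.norm_sq_sub_norm_sq [InnerProductSpace ℝ E] {u v : ℝ → E} {n : ℕ}
    (hn : 1 ≤ n) (hv : v =O[𝓝 0] fun t : ℝ => t) (huv : (fun t => u t - v t) =O[𝓝 0] fun t => t ^ n) :
    (fun t => ‖u t‖ ^ 2 - ‖v t‖ ^ 2) =O[𝓝 0] fun t => t ^ (n + 1) := by
  have hpow : (fun t : ℝ => t ^ n) =O[𝓝 0] fun t => t := by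
    obtain ⟨m, rfl⟩ := Nat.exists_eq_add_of_le' hn
    have hm : (fun t : ℝ => t ^ m) =O[𝓝 0] fun _ => (1 : ℝ) :=
      (continuous_pow m).continuousAt.tendsto.isBigO_one ℝ
    simpa [pow_succ] using hm.mul (isBigO_refl (fun t : ℝ => t) (𝓝 0))
  have hu : u =O[𝓝 0] fun t : ℝ => t :=
    ((huv.trans hpow).add hv).congr_left fun t => by simp
  have hinner : (fun t => ⟪u t - v t, u t + v t⟫) =O[𝓝 0] fun t => ‖u t - v t‖ * ‖u t + v t‖ :=
    isBigO_of_le _ fun t => by simpa using abs_real_inner_le_norm (u t - v t) (u t + v t)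
  refine ((hinner.trans (huv.norm_left.mul (hu.add hv).norm_left)).congr_left fun t => ?_).congr_right
    fun t => by ring
  rw [inner_add_right, inner_sub_left, inner_sub_left, real_inner_self_eq_norm_sq,
    real_inner_self_eq_norm_sq, real_inner_comm]
  ring

/-- A function that is constant on an open interval has vanishing derivative there. -/
theorem HasDerivAt.eq_zero_of_eqOn_Ioo {F : ℝ → ℝ} {F' a b c t : ℝ} (hF : HasDerivAt F F' t)
    (ht : t ∈ Set.Ioo a b) (hc : ∀ x ∈ Set.Ioo a b, F x = c) : F' = 0 := by
  have : F =ᶠ[𝓝 t] fun _ => c := by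
    filter_upwards [Ioo_mem_nhds ht.1 ht.2] with x hx using hc x hx
  exact hF.unique ((hasDerivAt_const t c).congr_of_eventuallyEq this)

/-- The inner products of the velocity with the higher derivatives of a unit-speed curve. -/
theorem inner_iteratedDeriv_of_unit_speed_s7 [InnerProductSpace ℝ E] {γ : ℝ → E}
    (hγ : ContDiff ℝ (⊤ : ℕ∞) γ) {a b : ℝ} (hunit : ∀ t ∈ Set.Ioo a b, ‖deriv γ t‖ = 1)
    {t : ℝ} (ht : t ∈ Set.Ioo a b) :
    ⟪iteratedDeriv 1 γ t, iteratedDeriv 1 γ t⟫ = 1 ∧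
    ⟪iteratedDeriv 1 γ t, iteratedDeriv 2 γ t⟫ = 0 ∧
    ⟪iteratedDeriv 1 γ t, iteratedDeriv 3 γ t⟫ = -‖iteratedDeriv 2 γ t‖ ^ 2 ∧
    ⟪iteratedDeriv 1 γ t, iteratedDeriv 4 γ t⟫ =
      -3 * ⟪iteratedDeriv 3 γ t, iteratedDeriv 2 γ t⟫ ∧
    ⟪iteratedDeriv 1 γ t, iteratedDeriv 5 γ t⟫ =
      -4 * ⟪iteratedDeriv 4 γ t, iteratedDeriv 2 γ t⟫ - 3 * ‖iteratedDeriv 3 γ t‖ ^ 2 := by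
  have hd (n : ℕ) (t : ℝ) : HasDerivAt (iteratedDeriv n γ) (iteratedDeriv (n + 1) γ t) t := by
    rw [iteratedDeriv_succ]
    exact (hγ.differentiable_iteratedDeriv n (mod_cast ENat.natCast_lt_top n) t).hasDerivAt
  have hi (m n : ℕ) (t : ℝ) := (hd m t).inner ℝ (hd n t)
  have h₁₁ : ∀ x ∈ Set.Ioo a b, ⟪iteratedDeriv 1 γ x, iteratedDeriv 1 γ x⟫ = 1 := fun x hx => by
    rw [real_inner_self_eq_norm_sq, iteratedDeriv_one, hunit x hx, one_pow]
  have h₁₂ : ∀ x ∈ Set.Ioo a b, ⟪iteratedDeriv 1 γ x, iteratedDeriv 2 γ x⟫ = 0 := fun x hx => by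
    have := (hi 1 1 x).eq_zero_of_eqOn_Ioo hx h₁₁
    rw [real_inner_comm (iteratedDeriv 1 γ x)] at this
    simp only [Nat.reduceAdd] at this
    linarith
  have h₁₃ : ∀ x ∈ Set.Ioo a b, ⟪iteratedDeriv 1 γ x, iteratedDeriv 3 γ x⟫ +
      ⟪iteratedDeriv 2 γ x, iteratedDeriv 2 γ x⟫ = 0 := fun x hx =>
    (hi 1 2 x).eq_zero_of_eqOn_Ioo hx h₁₂
  have h₁₄ : ∀ x ∈ Set.Ioo a b, ⟪iteratedDeriv 1 γ x, iteratedDeriv 4 γ x⟫ +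
      3 * ⟪iteratedDeriv 2 γ x, iteratedDeriv 3 γ x⟫ = 0 := fun x hx => by
    have := ((hi 1 3 x).add (hi 2 2 x)).eq_zero_of_eqOn_Ioo hx h₁₃
    simp only [Nat.reduceAdd] at this
    rw [real_inner_comm (iteratedDeriv 2 γ x) (iteratedDeriv 3 γ x)] at this
    linarith
  have h₁₅ : ⟪iteratedDeriv 1 γ t, iteratedDeriv 5 γ t⟫ +
      4 * ⟪iteratedDeriv 2 γ t, iteratedDeriv 4 γ t⟫ +
      3 * ⟪iteratedDeriv 3 γ t, iteratedDeriv 3 γ t⟫ = 0 := by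
    have := ((hi 1 4 t).add ((hi 2 3 t).const_mul 3)).eq_zero_of_eqOn_Ioo ht h₁₄
    simp only [Nat.reduceAdd] at this
    linarith
  have h₁₃ := h₁₃ t ht
  have h₁₄ := h₁₄ t ht
  rw [real_inner_self_eq_norm_sq] at h₁₃ h₁₅
  rw [real_inner_comm (iteratedDeriv 2 γ t) (iteratedDeriv 3 γ t),
    real_inner_comm (iteratedDeriv 2 γ t) (iteratedDeriv 4 γ t)]
  exact ⟨h₁₁ t ht, h₁₂ t ht, by linarith, by linarith, by linarith⟩

/-- The expansion of the squared chordal distance along a unit-speed curve. -/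
theorem norm_sub_sq_isBigO_of_unit_speed [InnerProductSpace ℝ E] {γ : ℝ → E}
    (hγ : ContDiff ℝ (⊤ : ℕ∞) γ) {a b : ℝ} (ha : a < 0) (hb : 0 < b)
    (hunit : ∀ t ∈ Set.Ioo a b, ‖deriv γ t‖ = 1) :
    (fun t : ℝ => ‖γ t - γ 0‖ ^ 2 - (t ^ 2 - 1 / 12 * ‖iteratedDeriv 2 γ 0‖ ^ 2 * t ^ 4 -
      1 / 12 * ⟪iteratedDeriv 3 γ 0, iteratedDeriv 2 γ 0⟫ * t ^ 5 -
      (1 / 40 * ⟪iteratedDeriv 4 γ 0, iteratedDeriv 2 γ 0⟫ +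
        1 / 45 * ‖iteratedDeriv 3 γ 0‖ ^ 2) * t ^ 6)) =O[𝓝 0] fun t => t ^ 7 := by
  obtain ⟨h₁₁, h₁₂, h₁₃, h₁₄, h₁₅⟩ := inner_iteratedDeriv_of_unit_speed_s7 hγ hunit ⟨ha, hb⟩
  have htaylor := ContDiff.sub_taylor_isBigO (contDiff_infty.mp hγ 6)
  simp only [Finset.sum_range_succ, Finset.sum_range_zero, iteratedDeriv_zero,
    Nat.factorial] at htaylor
  generalize iteratedDeriv 1 γ 0 = g₁ at *
  generalize iteratedDeriv 2 γ 0 = g₂ at *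
  generalize iteratedDeriv 3 γ 0 = g₃ at *
  generalize iteratedDeriv 4 γ 0 = g₄ at *
  generalize iteratedDeriv 5 γ 0 = g₅ at *
  let w : ℝ → E := fun t => g₁ + (t / 2) • g₂ + (t ^ 2 / 6) • g₃ + (t ^ 3 / 24) • g₄ +
    (t ^ 4 / 120) • g₅
  have hw : w =O[𝓝 0] fun _ => (1 : ℝ) :=
    (show Continuous w by fun_prop).continuousAt.tendsto.isBigO_one ℝ
  have hv : (fun t => t • w t) =O[𝓝 0] fun t : ℝ => t := by
    simpa using (isBigO_refl (fun t : ℝ => t) (𝓝 0)).smul hw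
  have huv : (fun t => (γ t - γ 0) - t • w t) =O[𝓝 0] fun t => t ^ 6 := by
    refine htaylor.congr_left fun t => ?_
    simp only [w]
    norm_num
    module
  have hpoly : (fun t : ℝ => ‖t • w t‖ ^ 2 - (t ^ 2 - 1 / 12 * ‖g₂‖ ^ 2 * t ^ 4 -
      1 / 12 * ⟪g₃, g₂⟫ * t ^ 5 -
      (1 / 40 * ⟪g₄, g₂⟫ + 1 / 45 * ‖g₃‖ ^ 2) * t ^ 6)) =O[𝓝 0] fun t => t ^ 7 := by
    have hK : (fun t : ℝ => ⟪g₅, g₂⟫ / 120 + ⟪g₄, g₃⟫ / 72 +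
        t * (⟪g₅, g₃⟫ / 360 + ‖g₄‖ ^ 2 / 576) + t ^ 2 * (⟪g₅, g₄⟫ / 1440) +
        t ^ 3 * (‖g₅‖ ^ 2 / 14400)) =O[𝓝 0] fun _ => (1 : ℝ) :=
      (Continuous.continuousAt (by fun_prop)).tendsto.isBigO_one ℝ
    refine (((isBigO_refl (fun t : ℝ => t ^ 7) (𝓝 0)).mul hK).congr_left fun t => ?_).congr_right
      fun t => by ring
    rw [norm_smul, mul_pow, Real.norm_eq_abs, sq_abs, ← real_inner_self_eq_norm_sq (w t)]
    simp only [w, inner_add_left, inner_add_right, real_inner_smul_left, real_inner_smul_right]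
    rw [real_inner_comm g₁ g₂, real_inner_comm g₁ g₃, real_inner_comm g₁ g₄, real_inner_comm g₁ g₅,
      real_inner_comm g₃ g₂, real_inner_comm g₄ g₂, real_inner_comm g₅ g₂, real_inner_comm g₄ g₃,
      real_inner_comm g₅ g₃, real_inner_comm g₅ g₄, h₁₁, h₁₂, h₁₃, h₁₄, h₁₅]
    simp only [real_inner_self_eq_norm_sq]
    ring
  exact ((hv.norm_sq_sub_norm_sq (by norm_num) huv).add hpoly).congr_left fun t => by ring

/-- Inversion of `s ^ 2 = t ^ 2 - 2 α t ^ 4 - 2 β t ^ 5 - 2 e t ^ 6 + O(t ^ 7)`. -/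
theorem isBigO_inverse_expansion_of_sq {s : ℝ → ℝ} (hs : ∀ t, 0 ≤ s t) {α β e : ℝ}
    (h : (fun t => s t ^ 2 - (t ^ 2 - 2 * α * t ^ 4 - 2 * β * t ^ 5 - 2 * e * t ^ 6))
      =O[𝓝[>] 0] fun t => t ^ 7) :
    (fun t => t - (s t + α * s t ^ 3 + β * s t ^ 4 + (e + 7 / 2 * α ^ 2) * s t ^ 5))
      =O[𝓝[>] 0] fun t => t ^ 6 := by
  let w : ℝ → ℝ := fun t => α + β * t + (e + α ^ 2 / 2) * t ^ 2
  let q : ℝ → ℝ := fun t => t * (1 - t ^ 2 * w t)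
  have bounded {f : ℝ → ℝ} (hf : Continuous f) : f =O[𝓝[>] 0] fun _ => (1 : ℝ) :=
    (hf.continuousAt.tendsto.mono_left nhdsWithin_le_nhds).isBigO_one ℝ
  have hw : Continuous w := by fun_prop
  have hq : Continuous q := by fun_prop
  have hsq : (fun t => s t ^ 2 - q t ^ 2) =O[𝓝[>] 0] fun t => t ^ 7 := by
    have hK := bounded (f := fun t => 2 * α * (β + (e + α ^ 2 / 2) * t) +
      t * (β + (e + α ^ 2 / 2) * t) ^ 2) (by fun_prop)
    have hr := (isBigO_refl (fun t : ℝ => t ^ 7) (𝓝[>] 0)).mul hK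
    simp only [mul_one] at hr
    refine (h.sub hr).congr_left fun t => ?_
    simp only [q, w]
    ring
  have hsub : (fun t => s t - q t) =O[𝓝[>] 0] fun t => t ^ 6 := by
    obtain ⟨C, hC⟩ := hsq.bound
    have hlim : ∀ᶠ t in 𝓝 (0 : ℝ), 1 / 2 < 1 - t ^ 2 * w t := by
      have : Continuous fun t => 1 - t ^ 2 * w t := by fun_prop
      exact this.continuousAt.eventually (lt_mem_nhds (by norm_num))
    refine IsBigO.of_bound (2 * C) ?_
    filter_upwards [hC, nhdsWithin_le_nhds hlim, self_mem_nhdsWithin] with t htC htw htpos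
    have htpos : 0 < t := htpos
    have hqt : t / 2 ≤ s t + q t := by
      have := mul_lt_mul_of_pos_left htw htpos
      have := hs t
      simp only [q]
      linarith
    rw [sq_sub_sq, norm_mul, Real.norm_of_nonneg (by linarith : 0 ≤ s t + q t),
      Real.norm_of_nonneg (by positivity : 0 ≤ t ^ 7)] at htC
    rw [Real.norm_of_nonneg (by positivity : 0 ≤ t ^ 6)]
    have := mul_le_mul_of_nonneg_right hqt (norm_nonneg (s t - q t))
    refine le_of_mul_le_mul_left ?_ htpos
    nlinarith
  have hs₀ : Tendsto s (𝓝[>] 0) (𝓝 0) := by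
    have hpow : Tendsto (fun t : ℝ => t ^ 6) (𝓝[>] 0) (𝓝 0) := by
      have := (continuous_pow 6 : Continuous fun t : ℝ => t ^ 6).tendsto 0
      simpa using this.mono_left nhdsWithin_le_nhds
    have := (hsub.trans_tendsto hpow).add (hq.continuousAt.tendsto.mono_left nhdsWithin_le_nhds)
    simpa [q] using this
  have hK : (fun t => 1 + α * (s t ^ 2 + s t * q t + q t ^ 2) +
      β * (s t ^ 3 + s t ^ 2 * q t + s t * q t ^ 2 + q t ^ 3) + (e + 7 / 2 * α ^ 2) *
      (s t ^ 4 + s t ^ 3 * q t + s t ^ 2 * q t ^ 2 + s t * q t ^ 3 + q t ^ 4))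
      =O[𝓝[>] 0] fun _ => (1 : ℝ) := by
    have hs₁ := hs₀.isBigO_one ℝ
    have hF : Continuous fun x : ℝ × ℝ => 1 + α * (x.1 ^ 2 + x.1 * x.2 + x.2 ^ 2) +
      β * (x.1 ^ 3 + x.1 ^ 2 * x.2 + x.1 * x.2 ^ 2 + x.2 ^ 3) + (e + 7 / 2 * α ^ 2) *
      (x.1 ^ 4 + x.1 ^ 3 * x.2 + x.1 ^ 2 * x.2 ^ 2 + x.1 * x.2 ^ 3 + x.2 ^ 4) := by fun_prop
    exact ((hF.tendsto _).comp (hs₀.prodMk_nhds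
      (hq.continuousAt.tendsto.mono_left nhdsWithin_le_nhds))).isBigO_one ℝ
  have hH := bounded (f := fun t =>
    3 * α * (β + (e + α ^ 2 / 2) * t) - α * t * w t ^ 2 * (3 - t ^ 2 * w t) +
      β * w t * (4 - 6 * (t ^ 2 * w t) + 4 * (t ^ 2 * w t) ^ 2 - (t ^ 2 * w t) ^ 3) +
      (e + 7 / 2 * α ^ 2) * t * w t * (5 - 10 * (t ^ 2 * w t) + 10 * (t ^ 2 * w t) ^ 2 -
        5 * (t ^ 2 * w t) ^ 3 + (t ^ 2 * w t) ^ 4)) (by fun_prop)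
  have hfinal := ((isBigO_refl (fun t : ℝ => t ^ 6) (𝓝[>] 0)).mul hH).sub (hsub.mul hK)
  simp only [mul_one] at hfinal
  refine hfinal.congr_left fun t => ?_
  simp only [q, w]
  ring

end Auxiliary

/-- Inverse expansion: the geodesic parameter `t` in terms of the chordal distance
`t̃(t) = ‖γ(t) − γ(0)‖`, as `t → 0⁺`, for a smooth unit-speed curve. -/
theorem parameter_in_terms_of_chordal_distance
    (p : ℕ) (hp : 1 ≤ p)
    (γ : ℝ → EuclideanSpace ℝ (Fin p))
    (hγ : ContDiff ℝ (⊤ : ℕ∞) γ)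
    (a b : ℝ) (ha : a < 0) (hb : 0 < b)
    (hunit : ∀ t ∈ Set.Ioo a b, ‖deriv γ t‖ = 1) :
    (fun t => t -
        (‖γ t - γ 0‖ + (1 / 24) * ‖iteratedDeriv 2 γ 0‖ ^ 2 * ‖γ t - γ 0‖ ^ 3 +
          (1 / 24) * ⟪iteratedDeriv 3 γ 0, iteratedDeriv 2 γ 0⟫ * ‖γ t - γ 0‖ ^ 4 +
          ((1 / 80) * ⟪iteratedDeriv 4 γ 0, iteratedDeriv 2 γ 0⟫ +
            (1 / 90) * ‖iteratedDeriv 3 γ 0‖ ^ 2 +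
            (7 / 1152) * ‖iteratedDeriv 2 γ 0‖ ^ 4) * ‖γ t - γ 0‖ ^ 5))
      =O[𝓝[>] (0 : ℝ)] fun t => t ^ 6 := by
  have h := (norm_sub_sq_isBigO_of_unit_speed hγ ha hb hunit).mono
    (nhdsWithin_le_nhds (s := Set.Ioi 0))
  refine (isBigO_inverse_expansion_of_sq (s := fun t => ‖γ t - γ 0‖)
    (α := 1 / 24 * ‖iteratedDeriv 2 γ 0‖ ^ 2)
    (β := 1 / 24 * ⟪iteratedDeriv 3 γ 0, iteratedDeriv 2 γ 0⟫)
    (e := 1 / 80 * ⟪iteratedDeriv 4 γ 0, iteratedDeriv 2 γ 0⟫ +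
      1 / 90 * ‖iteratedDeriv 3 γ 0‖ ^ 2) (fun t => norm_nonneg _)
    (h.congr_left fun t => by ring)).congr_left fun t => by ring
end

section
/- Let p ≥ 3 be an integer, let F : ℝ^{p−1} → ℝ be a smooth function, and for r > 0 set β(r) := (∫₀^r (1 − cos t)(sin t)^{p−2} dt)/(∫₀^r (1 − cos t)²(sin t)^{p−2} dt + r^{p+7}). Then, as r → 0⁺, ∫_{S^{p−2}} ∫₀^r (1 − (1 − cos t)·β(r))·(F(tθ) − F(0))·(sin t)^{p−2} dt dσ(θ) = −(1/(6(p+1)(p+3)(p+5)))·(∫_{S^{p−2}} D⁴F(0)[θ,θ,θ,θ] dσ(θ) + ∫_{S^{p−2}} D²F(0)[θ,θ] dσ(θ))·r^{p+3} + O(r^{p+5}), where D^kF(0)[θ,…,θ] denotes the k-th directional derivative of F at 0 along θ, i.e. the k-th derivative of s ↦ F(sθ) at s = 0. -/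
open Asymptotics Filter Topology MeasureTheory

/-- If `h t = O(t ^ k)` as `t → 0⁺` then `∫₀^r h = O(r ^ (k + 1))`. -/
lemma isBigO_intervalIntegral_pow {h : ℝ → ℝ} {k : ℕ}
    (hO : h =O[𝓝[>] (0 : ℝ)] fun t => t ^ k) :
    (fun r => ∫ t in (0 : ℝ)..r, h t) =O[𝓝[>] (0 : ℝ)] fun r => r ^ (k + 1) := by
  obtain ⟨C, hC0, hC⟩ := hO.exists_pos
  rw [isBigOWith_iff, eventually_nhdsWithin_iff, Metric.eventually_nhds_iff] at hC
  obtain ⟨δ, hδ, hb⟩ := hC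
  refine IsBigO.of_bound C ?_
  have : ∀ᶠ r : ℝ in 𝓝[>] (0 : ℝ), r ∈ Set.Ioo 0 δ := Ioo_mem_nhdsGT hδ
  filter_upwards [this] with r hr
  have := intervalIntegral.norm_integral_le_of_norm_le_const (a := 0) (b := r) (f := h)
    (C := C * r ^ k) (by
      intro t ht
      rw [Set.uIoc_of_le hr.1.le] at ht
      refine (hb (y := t) ?_ ht.1).trans ?_
      · rw [Real.dist_eq, sub_zero, abs_of_pos ht.1]; exact ht.2.trans_lt hr.2
      · rw [norm_pow, Real.norm_of_nonneg ht.1.le]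
        have := ht.1.le
        have := ht.2
        gcongr)
  refine this.trans_eq ?_
  rw [sub_zero, abs_of_pos hr.1, norm_pow, Real.norm_of_nonneg hr.1.le]
  ring

/-- `f t = a t ^ k + O(t ^ (k + 2))` as `t → 0⁺`. -/
def HasLeadingTerm (f : ℝ → ℝ) (a : ℝ) (k : ℕ) : Prop :=
  (fun t => f t - a * t ^ k) =O[𝓝[>] (0 : ℝ)] fun t => t ^ (k + 2)

lemma isBigO_pow_pow_nhdsGT {m n : ℕ} (h : m ≤ n) :
    (fun t : ℝ => t ^ n) =O[𝓝[>] (0 : ℝ)] fun t => t ^ m := by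
  refine IsBigO.of_bound' ?_
  filter_upwards [Ioo_mem_nhdsGT (one_pos (α := ℝ))] with t ht
  rw [norm_pow, norm_pow, Real.norm_of_nonneg ht.1.le]
  exact pow_le_pow_of_le_one ht.1.le ht.2.le h

namespace HasLeadingTerm

variable {f g : ℝ → ℝ} {a b : ℝ} {i j k : ℕ}

lemma isBigO (hf : HasLeadingTerm f a k) : f =O[𝓝[>] (0 : ℝ)] fun t => t ^ k := by
  have h1 : (fun t => f t - a * t ^ k) =O[𝓝[>] (0 : ℝ)] fun t : ℝ => t ^ k :=
    IsBigO.trans hf (isBigO_pow_pow_nhdsGT (by omega))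
  have h2 : (fun t => a * t ^ k) =O[𝓝[>] (0 : ℝ)] fun t : ℝ => t ^ k :=
    (isBigO_refl _ _).const_mul_left a
  simpa using h1.add h2

lemma of_isBigO (hf : f =O[𝓝[>] (0 : ℝ)] fun t => t ^ (k + 2)) : HasLeadingTerm f 0 k := by
  simpa [HasLeadingTerm] using hf

lemma isBigO_of_zero (hf : HasLeadingTerm f 0 k) : f =O[𝓝[>] (0 : ℝ)] fun t => t ^ (k + 2) := by
  simpa [HasLeadingTerm] using hf

lemma add (hf : HasLeadingTerm f a k) (hg : HasLeadingTerm g b k) :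
    HasLeadingTerm (fun t => f t + g t) (a + b) k := by
  refine (IsBigO.add hf hg).congr_left fun t => ?_
  ring

lemma const_mul (c : ℝ) (hf : HasLeadingTerm f a k) :
    HasLeadingTerm (fun t => c * f t) (c * a) k := by
  refine (IsBigO.const_mul_left hf c).congr_left fun t => ?_
  ring

lemma sub (hf : HasLeadingTerm f a k) (hg : HasLeadingTerm g b k) :
    HasLeadingTerm (fun t => f t - g t) (a - b) k := by
  refine (IsBigO.sub hf hg).congr_left fun t => ?_
  ring

lemma mul (hf : HasLeadingTerm f a i) (hg : HasLeadingTerm g b j) :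
    HasLeadingTerm (fun t => f t * g t) (a * b) (i + j) := by
  have h1 := IsBigO.mul hf hg.isBigO
  have h2 := IsBigO.mul ((isBigO_refl (fun t : ℝ => t ^ i) (𝓝[>] (0 : ℝ))).const_mul_left a) hg
  have h1' := h1.congr_right (g₂ := fun t : ℝ => t ^ (i + j + 2)) fun t => by ring
  have h2' := h2.congr_right (g₂ := fun t : ℝ => t ^ (i + j + 2)) fun t => by ring
  refine (h1'.add h2').congr_left fun t => ?_
  ring

lemma pow (hf : HasLeadingTerm f a i) (n : ℕ) :
    HasLeadingTerm (fun t => f t ^ n) (a ^ n) (n * i) := by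
  induction n with
  | zero => simpa [HasLeadingTerm] using isBigO_zero _ _
  | succ n ih => simpa only [pow_succ, Nat.succ_mul] using ih.mul hf

lemma monomial (a : ℝ) (k : ℕ) : HasLeadingTerm (fun t => a * t ^ k) a k := by
  simpa [HasLeadingTerm] using isBigO_zero _ _

lemma intervalIntegral (hc : Continuous f) (hf : HasLeadingTerm f a k) :
    HasLeadingTerm (fun r => ∫ t in (0 : ℝ)..r, f t) (a / (k + 1)) (k + 1) := by
  refine (isBigO_intervalIntegral_pow hf).congr_left fun r => ?_
  rw [intervalIntegral.integral_sub (hc.intervalIntegrable _ _)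
    ((by fun_prop : Continuous fun t : ℝ => a * t ^ k).intervalIntegrable _ _),
    intervalIntegral.integral_const_mul, integral_pow]
  simp
  ring

lemma pow_isBigO (ha : a ≠ 0) (hg : HasLeadingTerm g a i) :
    (fun t : ℝ => t ^ i) =O[𝓝[>] (0 : ℝ)] g := by
  have h0 : Tendsto (fun t : ℝ => t ^ 2) (𝓝[>] (0 : ℝ)) (𝓝 0) := by
    have : Continuous fun t : ℝ => t ^ 2 := by fun_prop
    simpa using (this.tendsto 0).mono_left nhdsWithin_le_nhds
  have hsmall : (fun t : ℝ => t ^ (i + 2)) =o[𝓝[>] (0 : ℝ)] fun t => a * t ^ i := by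
    have := ((isLittleO_one_iff ℝ).2 h0).mul_isBigO
      (isBigO_refl (fun t : ℝ => t ^ i) (𝓝[>] (0 : ℝ)))
    refine (this.congr (fun t => by ring) (fun t => one_mul _)).trans_isBigO ?_
    exact (isBigO_refl _ _).const_mul_right ha
  have hl : (fun t => g t - a * t ^ i) =o[𝓝[>] (0 : ℝ)] fun t => a * t ^ i :=
    IsBigO.trans_isLittleO hg hsmall
  refine IsBigO.trans ?_ (hl.right_isBigO_add.congr_right fun t => by ring)
  exact (isBigO_refl _ _).const_mul_right ha

lemma eventually_ne_zero (ha : a ≠ 0) (hg : HasLeadingTerm g a i) :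
    ∀ᶠ t in 𝓝[>] (0 : ℝ), g t ≠ 0 := by
  obtain ⟨C, hC⟩ := (hg.pow_isBigO ha).bound
  filter_upwards [hC, self_mem_nhdsWithin] with t ht ht0 h
  rw [h, norm_zero, mul_zero, norm_le_zero_iff] at ht
  exact pow_ne_zero _ (ne_of_gt ht0) ht

lemma div_isBigO (ha : a ≠ 0) (hg : HasLeadingTerm g a i)
    (hf : f =O[𝓝[>] (0 : ℝ)] fun t => t ^ (i + j)) :
    (fun t => f t / g t) =O[𝓝[>] (0 : ℝ)] fun t => t ^ j := by
  have hne : ∀ᶠ t : ℝ in 𝓝[>] (0 : ℝ), t ≠ 0 := by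
    filter_upwards [self_mem_nhdsWithin] with t ht using ne_of_gt ht
  have hinv := (hg.pow_isBigO ha).inv_rev (by
    filter_upwards [hne] with t ht h using absurd h (pow_ne_zero _ ht))
  refine ((hf.mul hinv).congr_left fun t => (div_eq_mul_inv _ _).symm).trans_eventuallyEq ?_
  filter_upwards [hne] with t ht
  field_simp
  ring

end HasLeadingTerm

lemma hasLeadingTerm_sin : HasLeadingTerm Real.sin 1 1 := by
  refine IsBigO.of_bound 1 ?_
  filter_upwards [Ioo_mem_nhdsGT (one_pos (α := ℝ))] with t ht
  have h := Real.sin_bound (x := t) (by rw [abs_of_pos ht.1]; exact ht.2.le)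
  have h3 : (0 : ℝ) ≤ t ^ 3 := pow_nonneg ht.1.le 3
  have h5 : t ^ 5 ≤ t ^ 3 := pow_le_pow_of_le_one ht.1.le ht.2.le (by norm_num)
  rw [abs_of_pos ht.1, abs_le] at h
  rw [Real.norm_eq_abs, Real.norm_of_nonneg h3, abs_le]
  constructor <;> linarith

lemma hasLeadingTerm_one_sub_cos : HasLeadingTerm (fun t => 1 - Real.cos t) (1 / 2) 2 := by
  refine IsBigO.of_bound 1 ?_
  filter_upwards [Ioo_mem_nhdsGT (one_pos (α := ℝ))] with t ht
  have h := Real.cos_bound (x := t) (by rw [abs_of_pos ht.1]; exact ht.2.le)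
  have h4 : (0 : ℝ) ≤ t ^ 4 := pow_nonneg ht.1.le 4
  rw [abs_of_pos ht.1, abs_le] at h
  rw [Real.norm_eq_abs, Real.norm_of_nonneg h4, abs_le]
  constructor <;> linarith

/-- Expansion of `1 - cos t` to fourth order. -/
lemma one_sub_cos_sub_isBigO :
    (fun t => (1 - Real.cos t) - (t ^ 2 / 2 - t ^ 4 / 24)) =O[𝓝[>] (0 : ℝ)] fun t => t ^ 6 := by
  have h : (fun t => Real.sin t - (t - t ^ 3 / 6)) =O[𝓝[>] (0 : ℝ)] fun t => t ^ 5 := by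
    refine IsBigO.of_bound (1 / 100) ?_
    filter_upwards [Ioo_mem_nhdsGT (one_pos (α := ℝ))] with t ht
    have h := Real.sin_bound (x := t) (by rw [abs_of_pos ht.1]; exact ht.2.le)
    rw [abs_of_pos ht.1] at h
    rw [Real.norm_eq_abs, Real.norm_of_nonneg (pow_nonneg ht.1.le 5)]
    linarith
  refine (isBigO_intervalIntegral_pow h).congr_left fun r => ?_
  rw [intervalIntegral.integral_eq_sub_of_hasDerivAt
    (f := fun t => (1 - Real.cos t) - (t ^ 2 / 2 - t ^ 4 / 24))]
  · simp
  · intro t _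
    have h1 := (Real.hasDerivAt_cos t).const_sub 1
    have h2 := ((hasDerivAt_pow 2 t).div_const 2).sub ((hasDerivAt_pow 4 t).div_const 24)
    refine (h1.sub h2).congr_deriv ?_
    norm_num
    ring
  · exact (by fun_prop : Continuous fun t : ℝ => Real.sin t - (t - t ^ 3 / 6)).intervalIntegrable _ _

/-- The moment `∫₀^r (1 - cos t)^k (sin t)^n dt`. -/
noncomputable def capMoment (n k : ℕ) (r : ℝ) : ℝ :=
  ∫ t in (0 : ℝ)..r, (1 - Real.cos t) ^ k * Real.sin t ^ n

lemma hasLeadingTerm_capMoment (n k : ℕ) :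
    HasLeadingTerm (capMoment n k) ((1 / 2) ^ k / (2 * k + n + 1)) (2 * k + n + 1) := by
  have h := (hasLeadingTerm_one_sub_cos.pow k).mul (hasLeadingTerm_sin.pow n)
  have := h.intervalIntegral (by fun_prop)
  have hk : k * 2 + n * 1 + 1 = 2 * k + n + 1 := by ring
  rw [hk] at this
  refine (congrArg (HasLeadingTerm (capMoment n k) · (2 * k + n + 1)) ?_).mp this
  push_cast
  rw [one_pow]
  ring

/-- The effect of the kernel `1 - (1 - cos t) β(r)` on a continuous radial profile
`a t² / 2 + b t⁴ / 24 + O(t⁶)`. -/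
lemma isBigO_radial_kernel_integral {n : ℕ} {β g : ℝ → ℝ} {a b : ℝ}
    (hβ : ∀ r, β r = capMoment n 1 r / (capMoment n 2 r + r ^ (n + 9)))
    (hg : Continuous g)
    (hga : (fun t => g t - (a * t ^ 2 / 2 + b * t ^ 4 / 24)) =O[𝓝[>] (0 : ℝ)] fun t => t ^ 6) :
    (fun r => (∫ t in (0 : ℝ)..r, (1 - (1 - Real.cos t) * β r) * g t * Real.sin t ^ n) -
      -(1 / (6 * ((n : ℝ) + 3) * (n + 5) * (n + 7))) * (b + a) * r ^ (n + 5))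
      =O[𝓝[>] (0 : ℝ)] fun r => r ^ (n + 7) := by
  set u : ℝ → ℝ := fun t => 1 - Real.cos t with hu
  have huc : Continuous u := by fun_prop
  set h : ℝ → ℝ := fun t => g t - (a * u t + (a + b) / 6 * u t ^ 2) with hh
  have hhc : Continuous h := by fun_prop
  have hO : h =O[𝓝[>] (0 : ℝ)] fun t => t ^ 6 := by
    have h1 := one_sub_cos_sub_isBigO.const_mul_left a
    have h2 := IsBigO.const_mul_left (hasLeadingTerm_one_sub_cos.pow 2) ((a + b) / 6)
    refine ((hga.sub h1).sub h2).congr_left fun t => ?_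
    simp only [hh, hu]
    ring
  set D : ℝ → ℝ := fun r => capMoment n 2 r + r ^ (n + 9) with hD
  have hn : (0 : ℝ) ≤ n := n.cast_nonneg
  have hM1 : HasLeadingTerm (capMoment n 1) (1 / (2 * (n + 3))) (n + 3) := by
    convert hasLeadingTerm_capMoment n 1 using 1
    · push_cast; field_simp; ring
    · ring
  have hM2 : HasLeadingTerm (capMoment n 2) (1 / (4 * (n + 5))) (n + 5) := by
    convert hasLeadingTerm_capMoment n 2 using 1
    · push_cast; field_simp; ring
    · ring
  have hM3 : HasLeadingTerm (capMoment n 3) (1 / (8 * (n + 7))) (n + 7) := by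
    convert hasLeadingTerm_capMoment n 3 using 1
    · push_cast; field_simp; ring
    · ring
  have hD2 : HasLeadingTerm D (1 / (4 * (n + 5))) (n + 5) := by
    simpa using hM2.add (HasLeadingTerm.of_isBigO (isBigO_pow_pow_nhdsGT (n := n + 9) (by omega)))
  have ha2 : (1 / (4 * ((n : ℝ) + 5))) ≠ 0 := by positivity
  -- the linear term is annihilated up to the regularization
  have hlin : (fun r => capMoment n 1 r * r ^ (n + 9) / D r) =O[𝓝[>] (0 : ℝ)]
      fun r => r ^ (n + 7) := by
    refine hD2.div_isBigO ha2 ?_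
    refine (hM1.isBigO.mul (isBigO_refl (fun r : ℝ => r ^ (n + 9)) _)).congr_right fun r => ?_
    ring
  have hquad : (fun r => (capMoment n 2 r * D r - capMoment n 1 r * capMoment n 3 r -
      -(1 / (((n : ℝ) + 3) * (n + 5) * (n + 7))) * r ^ (n + 5) * D r) / D r) =O[𝓝[>] (0 : ℝ)]
      fun r => r ^ (n + 7) := by
    refine hD2.div_isBigO ha2 ?_
    have h1 : HasLeadingTerm (fun r => capMoment n 1 r * capMoment n 3 r)
        (1 / (2 * (n + 3)) * (1 / (8 * (n + 7)))) (n + 5 + (n + 5)) := by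
      convert hM1.mul hM3 using 1
      ring
    have h2 := ((hM2.mul hD2).sub h1).sub
      ((HasLeadingTerm.monomial (-(1 / (((n : ℝ) + 3) * (n + 5) * (n + 7)))) (n + 5)).mul hD2)
    have h3 := HasLeadingTerm.isBigO_of_zero (by
      convert h2 using 1
      field_simp
      ring)
    exact h3
  have hw : Continuous fun t => h t * Real.sin t ^ n := by fun_prop
  have herr1 : (fun r => ∫ t in (0 : ℝ)..r, h t * Real.sin t ^ n) =O[𝓝[>] (0 : ℝ)]
      fun r => r ^ (n + 7) := by
    refine (isBigO_intervalIntegral_pow (k := n + 6) ?_)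
    refine (hO.mul (hasLeadingTerm_sin.pow n).isBigO).congr_right fun r => ?_
    ring
  have herr2 : (fun r => capMoment n 1 r * (∫ t in (0 : ℝ)..r, u t * h t * Real.sin t ^ n) / D r)
      =O[𝓝[>] (0 : ℝ)] fun r => r ^ (n + 7) := by
    have h1 : (fun r => ∫ t in (0 : ℝ)..r, u t * h t * Real.sin t ^ n) =O[𝓝[>] (0 : ℝ)]
        fun r => r ^ (n + 9) := by
      refine (isBigO_intervalIntegral_pow (k := n + 8) ?_)
      refine ((hasLeadingTerm_one_sub_cos.isBigO.mul hO).mul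
        (hasLeadingTerm_sin.pow n).isBigO).congr_right fun r => ?_
      ring
    refine hD2.div_isBigO ha2 ((hM1.isBigO.mul h1).congr_right fun r => ?_)
    ring
  have key : ∀ r, (∫ t in (0 : ℝ)..r, (1 - (1 - Real.cos t) * β r) * g t * Real.sin t ^ n) =
      a * (capMoment n 1 r - β r * capMoment n 2 r) +
      (a + b) / 6 * (capMoment n 2 r - β r * capMoment n 3 r) +
      ((∫ t in (0 : ℝ)..r, h t * Real.sin t ^ n) -
        β r * ∫ t in (0 : ℝ)..r, u t * h t * Real.sin t ^ n) := by
    intro r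
    have hi : ∀ k : ℕ, IntervalIntegrable (fun t => u t ^ k * Real.sin t ^ n) volume 0 r :=
      fun k => (by fun_prop : Continuous _).intervalIntegrable _ _
    have hi1 : IntervalIntegrable (fun t => h t * Real.sin t ^ n) volume 0 r :=
      hw.intervalIntegrable _ _
    have hi2 : IntervalIntegrable (fun t => u t * h t * Real.sin t ^ n) volume 0 r :=
      (by fun_prop : Continuous _).intervalIntegrable _ _
    simp only [capMoment]
    rw [← intervalIntegral.integral_const_mul, ← intervalIntegral.integral_const_mul,
      ← intervalIntegral.integral_const_mul,
      ← intervalIntegral.integral_sub (hi 1) ((hi 2).const_mul _),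
      ← intervalIntegral.integral_sub (hi 2) ((hi 3).const_mul _),
      ← intervalIntegral.integral_sub hi1 (hi2.const_mul _),
      ← intervalIntegral.integral_const_mul, ← intervalIntegral.integral_const_mul,
      ← intervalIntegral.integral_add (((hi 1).sub ((hi 2).const_mul _)).const_mul _)
        (((hi 2).sub ((hi 3).const_mul _)).const_mul _),
      ← intervalIntegral.integral_add ((((hi 1).sub ((hi 2).const_mul _)).const_mul _).add
        (((hi 2).sub ((hi 3).const_mul _)).const_mul _)) (hi1.sub (hi2.const_mul _))]
    congr 1
    ext t
    simp only [hh, hu]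
    ring
  refine ((((hlin.const_mul_left a).add (hquad.const_mul_left ((a + b) / 6))).add herr1).sub
    herr2).congr' ?_ EventuallyEq.rfl
  filter_upwards [hD2.eventually_ne_zero ha2] with r hr
  rw [key r, hβ r]
  have hD' : capMoment n 2 r + r ^ (n + 9) = D r := rfl
  have hM : capMoment n 2 r = D r - r ^ (n + 9) := by simp [hD]
  rw [hD', hM]
  field_simp
  ring

/-- The Hausdorff measure of the unit sphere of `ℝ^{m+1}` in dimension `m` is finite: the sphere
is covered by the radial projections of the faces of a cube. -/
lemma hausdorffMeasure_sphere_lt_top (m : ℕ) :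
    μH[(m : ℝ)] (Metric.sphere (0 : EuclideanSpace ℝ (Fin (m + 1))) 1) < ⊤ := by
  set K : Set (Fin m → ℝ) := Set.Icc (-1) 1 with hK
  have hKfin : μH[(m : ℝ)] K < ⊤ := by
    have h := hausdorffMeasure_pi_real (ι := Fin m)
    rw [Fintype.card_fin] at h
    rw [h]
    exact isCompact_Icc.measure_lt_top
  let lift : Fin (m + 1) × ({1, -1} : Finset ℝ) → (Fin m → ℝ) → EuclideanSpace ℝ (Fin (m + 1)) :=
    fun q y => WithLp.toLp 2 (q.1.insertNth (α := fun _ => ℝ) (q.2 : ℝ) y)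
  let proj : Fin (m + 1) × ({1, -1} : Finset ℝ) → (Fin m → ℝ) → EuclideanSpace ℝ (Fin (m + 1)) :=
    fun q y => ‖lift q y‖⁻¹ • lift q y
  have hcover : Metric.sphere (0 : EuclideanSpace ℝ (Fin (m + 1))) 1 ⊆ ⋃ q, proj q '' K := by
    intro x hx
    have hx1 : ‖x‖ = 1 := by simpa using hx
    obtain ⟨i, hi⟩ := Finite.exists_max fun j => |x j|
    have hxi : 0 < |x i| := by
      by_contra hcon
      have : x = 0 := by
        ext j
        exact abs_nonpos_iff.1 ((hi j).trans (not_lt.1 hcon))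
      simp [this] at hx1
    have hs : x i / |x i| ∈ ({1, -1} : Finset ℝ) := by
      rcases abs_cases (x i) with ⟨h, h'⟩ | ⟨h, h'⟩
      · rw [h, div_self (by rw [h] at hxi; exact hxi.ne')]; simp
      · rw [h, div_neg, div_self h'.ne]; simp
    have hl : lift (i, ⟨x i / |x i|, hs⟩) (fun j => x (i.succAbove j) / |x i|) = |x i|⁻¹ • x := by
      ext j
      simp only [lift, PiLp.smul_apply, smul_eq_mul]
      rcases eq_or_ne j i with rfl | hj
      · simp [div_eq_inv_mul]
      · obtain ⟨j, rfl⟩ := Fin.exists_succAbove_eq hj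
        simp [div_eq_inv_mul]
    refine Set.mem_iUnion.2 ⟨(i, ⟨x i / |x i|, hs⟩), fun j => x (i.succAbove j) / |x i|, ?_, ?_⟩
    · have hb : ∀ j, abs (x (i.succAbove j) / |x i|) ≤ 1 := fun j => by
        rw [abs_div, abs_abs, div_le_one hxi]
        exact hi _
      exact ⟨fun j => (abs_le.1 (hb j)).1, fun j => (abs_le.1 (hb j)).2⟩
    · simp only [proj]
      rw [hl, norm_smul, hx1, norm_inv, Real.norm_eq_abs, abs_abs, mul_one, inv_inv, smul_smul,
        mul_inv_cancel₀ hxi.ne', one_smul]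
  have hlip : ∀ q, μH[(m : ℝ)] (proj q '' K) < ⊤ := by
    intro q
    have hne : ∀ y, lift q y ≠ 0 := by
      intro y h
      have h0 : (q.2 : ℝ) = 0 := by
        have := congrArg (fun z : EuclideanSpace ℝ (Fin (m + 1)) => z q.1) h
        simpa [lift] using this
      have := q.2.2
      rw [h0] at this
      simp at this
    have hsm : ContDiff ℝ 1 (lift q) := by
      rw [contDiff_euclidean]
      intro j
      rcases eq_or_ne j q.1 with rfl | hj
      · simpa [lift] using contDiff_const
      · obtain ⟨j, rfl⟩ := Fin.exists_succAbove_eq hj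
        simpa [lift] using contDiff_apply ℝ ℝ j
    have hp : ContDiff ℝ 1 (proj q) :=
      ((hsm.norm ℝ hne).inv fun y => norm_ne_zero_iff.2 (hne y)).smul hsm
    obtain ⟨L, hL⟩ := hp.contDiffOn.exists_lipschitzOnWith one_ne_zero (convex_Icc (-1) 1)
      (isCompact_Icc (a := (-1 : Fin m → ℝ)) (b := 1))
    refine (hL.hausdorffMeasure_image_le m.cast_nonneg).trans_lt ?_
    exact ENNReal.mul_lt_top (ENNReal.rpow_lt_top_of_nonneg m.cast_nonneg ENNReal.coe_ne_top) hKfin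
  exact (measure_mono hcover).trans_lt
    ((measure_iUnion_le _).trans_lt (by
      rw [tsum_fintype]
      exact ENNReal.sum_lt_top.2 fun q _ => hlip q))

section Profile

variable {E : Type*} [NormedAddCommGroup E] [InnerProductSpace ℝ E]
  {F : E → ℝ}

lemma iteratedDeriv_comp_smul_eq (hF : ContDiff ℝ (⊤ : ℕ∞) F) (k : ℕ) (θ : E) (s : ℝ) :
    iteratedDeriv k (fun s : ℝ => F (s • θ)) s = iteratedFDeriv ℝ k F (s • θ) fun _ => θ := by
  have h := (ContinuousLinearMap.toSpanSingleton ℝ θ).iteratedFDeriv_comp_right hF s (i := k)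
    (by exact_mod_cast le_top)
  have h' : (fun s : ℝ => F (s • θ)) = F ∘ ContinuousLinearMap.toSpanSingleton ℝ θ := by
    ext s
    simp
  rw [iteratedDeriv_eq_iteratedFDeriv, h', h]
  simp

lemma continuous_iteratedDeriv_comp_smul (hF : ContDiff ℝ (⊤ : ℕ∞) F) (k : ℕ) :
    Continuous fun q : ℝ × E => iteratedDeriv k (fun s : ℝ => F (s • q.2)) q.1 := by
  simp_rw [iteratedDeriv_comp_smul_eq hF]
  have h1 : Continuous fun q : ℝ × E => iteratedFDeriv ℝ k F (q.1 • q.2) :=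
    (hF.continuous_iteratedFDeriv (by exact_mod_cast le_top)).comp (by fun_prop)
  fun_prop

lemma integral_iteratedDeriv_odd [MeasurableSpace E] [BorelSpace E] {ν : Measure E}
    (hneg : MeasurePreserving (fun θ : E => -θ) ν ν) {k : ℕ} (hk : Odd k) :
    ∫ θ, iteratedDeriv k (fun s : ℝ => F (s • θ)) 0 ∂ν = 0 := by
  have h1 := hneg.integral_comp (Homeomorph.neg E).measurableEmbedding
    fun θ => iteratedDeriv k (fun s : ℝ => F (s • θ)) 0
  have h2 : ∀ θ : E, iteratedDeriv k (fun s : ℝ => F (s • -θ)) 0 =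
      -iteratedDeriv k (fun s : ℝ => F (s • θ)) 0 := by
    intro θ
    have := iteratedDeriv_comp_neg k (fun s : ℝ => F (s • θ)) 0
    simpa [hk.neg_one_pow] using this
  simp_rw [h2, integral_neg] at h1
  linarith

variable [FiniteDimensional ℝ E]

/-- Taylor expansion of `F` along rays, uniformly over the unit sphere. -/
lemma exists_taylor_bound_sphere (hF : ContDiff ℝ (⊤ : ℕ∞) F) (n : ℕ) :
    ∃ C, ∀ θ ∈ Metric.sphere (0 : E) 1, ∀ t ∈ Set.Icc (0 : ℝ) 1,
      |F (t • θ) - ∑ k ∈ Finset.range (n + 1),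
        (k.factorial : ℝ)⁻¹ * t ^ k * iteratedDeriv k (fun s : ℝ => F (s • θ)) 0|
        ≤ C * t ^ (n + 1) := by
  obtain ⟨C, hC⟩ := ((isCompact_Icc (a := (0 : ℝ)) (b := 1)).prod
    (isCompact_sphere (0 : E) 1)).exists_bound_of_continuousOn
      (continuous_iteratedDeriv_comp_smul hF (n + 1)).continuousOn
  refine ⟨C / n.factorial, fun θ hθ t ht => ?_⟩
  have hφ : ContDiff ℝ (⊤ : ℕ∞) fun s : ℝ => F (s • θ) := hF.comp (by fun_prop)
  have hd : ∀ k : ℕ, ∀ y ∈ Set.Icc (0 : ℝ) 1,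
      iteratedDerivWithin k (fun s : ℝ => F (s • θ)) (Set.Icc 0 1) y =
        iteratedDeriv k (fun s : ℝ => F (s • θ)) y := fun k y hy =>
    iteratedDerivWithin_eq_iteratedDeriv (uniqueDiffOn_Icc one_pos)
      (hφ.of_le (by exact_mod_cast le_top)).contDiffAt hy
  have h := taylor_mean_remainder_bound (f := fun s : ℝ => F (s • θ)) (n := n) (C := C)
    zero_le_one (hφ.of_le (by exact_mod_cast le_top)).contDiffOn ht (fun y hy => by
      rw [hd _ y hy]
      exact hC (y, θ) ⟨hy, hθ⟩)
  rw [taylor_within_apply, Real.norm_eq_abs, sub_zero] at h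
  rw [div_mul_eq_mul_div]
  convert h using 5
  rw [hd _ 0 ⟨le_rfl, zero_le_one⟩, smul_eq_mul]

variable [MeasurableSpace E] [BorelSpace E] {ν : Measure E} [IsFiniteMeasure ν]

lemma Continuous.integrable_of_restrict_sphere (hν : ν.restrict (Metric.sphere (0 : E) 1) = ν)
    {f : E → ℝ} (hf : Continuous f) : Integrable f ν := by
  rw [← hν]
  exact hf.continuousOn.integrableOn_compact (isCompact_sphere _ _)

/-- Expansion of the spherical mean of a smooth function. -/
lemma isBigO_spherical_profile (hF : ContDiff ℝ (⊤ : ℕ∞) F)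
    (hν : ν.restrict (Metric.sphere (0 : E) 1) = ν)
    (hneg : MeasurePreserving (fun θ : E => -θ) ν ν) :
    (fun t : ℝ => (∫ θ, (F (t • θ) - F 0) ∂ν) -
      ((∫ θ, iteratedDeriv 2 (fun s : ℝ => F (s • θ)) 0 ∂ν) * t ^ 2 / 2 +
        (∫ θ, iteratedDeriv 4 (fun s : ℝ => F (s • θ)) 0 ∂ν) * t ^ 4 / 24))
      =O[𝓝[>] (0 : ℝ)] fun t => t ^ 6 := by
  obtain ⟨C, hC⟩ := exists_taylor_bound_sphere hF 5
  have hFc : Continuous F := hF.continuous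
  have hint : ∀ k : ℕ, Integrable (fun θ => iteratedDeriv k (fun s : ℝ => F (s • θ)) 0) ν :=
    fun k => Continuous.integrable_of_restrict_sphere hν
      ((continuous_iteratedDeriv_comp_smul hF k).comp
        (by fun_prop : Continuous fun θ : E => ((0 : ℝ), θ)))
  refine IsBigO.of_bound (C * ν.real Set.univ) ?_
  filter_upwards [Ioo_mem_nhdsGT (one_pos (α := ℝ))] with t ht
  have hFt : Integrable (fun θ => F (t • θ)) ν :=
    Continuous.integrable_of_restrict_sphere hν (by fun_prop)
  have hsum : Integrable (fun θ => ∑ k ∈ Finset.range (5 + 1),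
      (k.factorial : ℝ)⁻¹ * t ^ k * iteratedDeriv k (fun s : ℝ => F (s • θ)) 0) ν :=
    integrable_finsetSum _ fun k _ => (hint k).const_mul _
  have heq : (∫ θ, (F (t • θ) - F 0) ∂ν) -
      ((∫ θ, iteratedDeriv 2 (fun s : ℝ => F (s • θ)) 0 ∂ν) * t ^ 2 / 2 +
        (∫ θ, iteratedDeriv 4 (fun s : ℝ => F (s • θ)) 0 ∂ν) * t ^ 4 / 24) =
      ∫ θ, (F (t • θ) - ∑ k ∈ Finset.range (5 + 1),
        (k.factorial : ℝ)⁻¹ * t ^ k * iteratedDeriv k (fun s : ℝ => F (s • θ)) 0) ∂ν := by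
    rw [integral_sub hFt (integrable_const _), integral_sub hFt hsum,
      integral_finsetSum _ fun k _ => (hint k).const_mul _]
    simp_rw [integral_const_mul]
    simp only [Finset.sum_range_succ, Finset.sum_range_zero,
      integral_iteratedDeriv_odd hneg (F := F) (k := 1) (by decide),
      integral_iteratedDeriv_odd hneg (F := F) (k := 3) (by decide),
      integral_iteratedDeriv_odd hneg (F := F) (k := 5) (by decide)]
    simp [Nat.factorial]
    ring
  rw [heq, Real.norm_of_nonneg (pow_nonneg ht.1.le 6)]
  refine (norm_integral_le_of_norm_le_const (C := C * t ^ 6) ?_).trans_eq (by ring)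
  rw [← hν]
  filter_upwards [ae_restrict_mem Metric.isClosed_sphere.measurableSet] with θ hθ
  exact hC θ hθ t ⟨ht.1.le, ht.2.le⟩

/-- The spherical and radial integrals of a continuous function commute. -/
lemma integral_intervalIntegral_swap_of_restrict_sphere
    (hν : ν.restrict (Metric.sphere (0 : E) 1) = ν) {f : ℝ → E → ℝ}
    (hf : Continuous (Function.uncurry f)) (a b : ℝ) :
    ∫ θ, (∫ t in a..b, f t θ) ∂ν = ∫ t in a..b, ∫ θ, f t θ ∂ν := by
  refine (intervalIntegral_integral_swap ?_).symm
  rw [← hν, Measure.prod_restrict]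
  exact (hf.continuousOn.integrableOn_compact
    (isCompact_uIcc.prod (isCompact_sphere (0 : E) 1))).mono_set
    (Set.prod_mono Set.uIoc_subset_uIcc subset_rfl)

end Profile

/-- Expansion of the LLE kernel integral against `F − F(0)` on the unit sphere
`S^{p-1} ⊂ ℝ^p` (regularization order `ρ = 8`), in normal coordinates: the `r^{p+3}`
coefficient is a fourth-order differential operator. -/
theorem sphere_kernel_operator_expansion
    (p : ℕ) (hp : 3 ≤ p)
    (F : EuclideanSpace ℝ (Fin (p - 1)) → ℝ) (hF : ContDiff ℝ (⊤ : ℕ∞) F)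
    (β : ℝ → ℝ)
    (hβ : ∀ r, β r =
      (∫ t in (0 : ℝ)..r, (1 - Real.cos t) * Real.sin t ^ (p - 2)) /
        ((∫ t in (0 : ℝ)..r, (1 - Real.cos t) ^ 2 * Real.sin t ^ (p - 2)) + r ^ (p + 7)))
    (S : Set (EuclideanSpace ℝ (Fin (p - 1))))
    (hS : S = Metric.sphere (0 : EuclideanSpace ℝ (Fin (p - 1))) 1)
    (σ : Measure (EuclideanSpace ℝ (Fin (p - 1))))
    (hσ : σ = μH[(p : ℝ) - 2]) :
    (fun r : ℝ =>
        (∫ θ in S,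
            (∫ t in (0 : ℝ)..r,
              (1 - (1 - Real.cos t) * β r) * (F (t • θ) - F 0) * Real.sin t ^ (p - 2)) ∂σ) -
          (-(1 / (6 * ((p : ℝ) + 1) * ((p : ℝ) + 3) * ((p : ℝ) + 5))) *
            ((∫ θ in S, iteratedDeriv 4 (fun s : ℝ => F (s • θ)) 0 ∂σ) +
              (∫ θ in S, iteratedDeriv 2 (fun s : ℝ => F (s • θ)) 0 ∂σ)) * r ^ (p + 3)))
      =O[𝓝[>] (0 : ℝ)] fun r => r ^ (p + 5) := by
  obtain ⟨n, rfl⟩ : ∃ n, p = n + 2 := ⟨p - 2, by omega⟩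
  have hcast : ((n + 2 : ℕ) : ℝ) - 2 = n := by push_cast; ring
  rw [hcast] at hσ
  have hfin : σ S < ⊤ := by
    rw [hS, hσ]
    exact hausdorffMeasure_sphere_lt_top n
  have hSm : MeasurableSet S := hS ▸ Metric.isClosed_sphere.measurableSet
  have hneg : MeasurePreserving (fun θ => -θ) (σ.restrict S) (σ.restrict S) := by
    have h := ((IsometryEquiv.neg
      (EuclideanSpace ℝ (Fin (n + 2 - 1)))).measurePreserving_hausdorffMeasure
        (n : ℝ)).restrict_preimage hSm
    rw [← hσ] at h
    have hpre : IsometryEquiv.neg (EuclideanSpace ℝ (Fin (n + 2 - 1))) ⁻¹' S = S := by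
      ext θ
      simp [hS]
    rw [hpre] at h
    exact h
  have : IsFiniteMeasure (σ.restrict S) := ⟨by rwa [Measure.restrict_apply_univ]⟩
  have hν : (σ.restrict S).restrict (Metric.sphere 0 1) = σ.restrict S := by
    rw [← hS, Measure.restrict_restrict hSm, Set.inter_self]
  generalize σ.restrict S = ν at *
  have hFc : Continuous F := hF.continuous
  have hg : Continuous fun t : ℝ => ∫ θ, (F (t • θ) - F 0) ∂ν := by
    have := continuous_parametric_integral_of_continuous (μ := ν)
      (f := fun (t : ℝ) θ => F (t • θ) - F 0) (by fun_prop)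
      (isCompact_sphere (0 : EuclideanSpace ℝ (Fin (n + 2 - 1))) 1)
    rwa [hν] at this
  have hmain := isBigO_radial_kernel_integral (n := n) (β := β)
    (fun r => by simpa [capMoment] using hβ r) hg (isBigO_spherical_profile hF hν hneg)
  refine hmain.congr_left fun r => ?_
  rw [integral_intervalIntegral_swap_of_restrict_sphere hν
    (f := fun t θ => (1 - (1 - Real.cos t) * β r) * (F (t • θ) - F 0) * Real.sin t ^ (n + 2 - 2))
    (by fun_prop)]
  simp_rw [integral_mul_const, integral_const_mul]
  simp only [Nat.add_sub_cancel]
  have h1 : ((n + 2 : ℕ) : ℝ) + 1 = n + 3 := by push_cast; ring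
  have h3 : ((n + 2 : ℕ) : ℝ) + 3 = n + 5 := by push_cast; ring
  have h5 : ((n + 2 : ℕ) : ℝ) + 5 = n + 7 := by push_cast; ring
  rw [h1, h3, h5]
end

section
/- Let 0 < d < p be integers and λ ≠ 0 a real number. Let A, X, Λ : ℝ → ℝ^{p×p} be matrix-valued functions, twice differentiable at 0, such that for all ε in a neighborhood of 0: A(ε)·X(ε) = X(ε)·Λ(ε) and Λ(ε) is a diagonal matrix. Assume A(0) = Λ(0) is block diagonal with (1,1)-block λ·I_d and all other blocks zero, and X(0) is block diagonal with blocks X₁, X₂ satisfying X₁ᵀX₁ = I_d and X₂ᵀX₂ = I_{p−d}. Write A'(0), A''(0) in 2×2 block form (A'ᵢⱼ, A''ᵢⱼ), Λ'(0) = diag(Λ'₁, Λ'₂), Λ''(0) = diag(Λ''₁, Λ''₂), and C := X(0)ᵀ·X'(0) with blocks Cᵢⱼ. Then: X₁ᵀ·(A''₁₁·X₁ + 2·A'₁₂·X₂·C₂₁) = 2·(C₁₁·Λ'₁ − Λ'₁·C₁₁) + Λ''₁, and X₂ᵀ·(A''₂₂·X₂ + 2·A'₂₁·X₁·C₁₂)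 = 2·(C₂₂·Λ'₂ − Λ'₂·C₂₂) + Λ''₂. -/
open Matrix Filter Topology

/-- The entrywise derivative of a matrix-valued function of a real variable. -/
noncomputable def Matrix.entryDeriv {m n : Type*} (F : ℝ → Matrix m n ℝ) (t : ℝ) : Matrix m n ℝ :=
  Matrix.of fun i j => deriv (fun ε => F ε i j) t

lemma Matrix.hasDerivAt_mul_apply {l m n : Type*} [Fintype m] {P : ℝ → Matrix l m ℝ}
    {Q : ℝ → Matrix m n ℝ} {t : ℝ}
    (hP : ∀ i j, DifferentiableAt ℝ (fun ε => P ε i j) t)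
    (hQ : ∀ i j, DifferentiableAt ℝ (fun ε => Q ε i j) t) (i : l) (j : n) :
    HasDerivAt (fun ε => (P ε * Q ε) i j)
      ((entryDeriv P t * Q t + P t * entryDeriv Q t) i j) t := by
  simp only [Matrix.mul_apply, Matrix.add_apply, ← Finset.sum_add_distrib]
  exact HasDerivAt.fun_sum fun k _ => (hP i k).hasDerivAt.fun_mul (hQ k j).hasDerivAt

lemma Matrix.entryDeriv_mul {l m n : Type*} [Fintype m] {P : ℝ → Matrix l m ℝ}
    {Q : ℝ → Matrix m n ℝ} {t : ℝ}
    (hP : ∀ i j, DifferentiableAt ℝ (fun ε => P ε i j) t)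
    (hQ : ∀ i j, DifferentiableAt ℝ (fun ε => Q ε i j) t) :
    entryDeriv (fun ε => P ε * Q ε) t = entryDeriv P t * Q t + P t * entryDeriv Q t := by
  ext i j
  exact (hasDerivAt_mul_apply hP hQ i j).deriv

lemma Filter.EventuallyEq.entryDeriv {m n : Type*} {F G : ℝ → Matrix m n ℝ} {t : ℝ}
    (h : F =ᶠ[𝓝 t] G) : Matrix.entryDeriv F =ᶠ[𝓝 t] Matrix.entryDeriv G := by
  filter_upwards [h.eventuallyEq_nhds] with s hs
  ext i j
  exact Filter.EventuallyEq.deriv_eq (hs.mono fun ε hε => congrFun (congrFun hε i) j)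

lemma Matrix.entryDeriv_entryDeriv_mul {l m n : Type*} [Finite l] [Fintype m] [Finite n]
    {P : ℝ → Matrix l m ℝ} {Q : ℝ → Matrix m n ℝ} {t : ℝ}
    (hP : ∀ i j, (∀ᶠ s in 𝓝 t, DifferentiableAt ℝ (fun ε => P ε i j) s) ∧
      DifferentiableAt ℝ (deriv fun ε => P ε i j) t)
    (hQ : ∀ i j, (∀ᶠ s in 𝓝 t, DifferentiableAt ℝ (fun ε => Q ε i j) s) ∧
      DifferentiableAt ℝ (deriv fun ε => Q ε i j) t) :
    entryDeriv (entryDeriv fun ε => P ε * Q ε) t =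
      entryDeriv (entryDeriv P) t * Q t + (2 : ℝ) • (entryDeriv P t * entryDeriv Q t) +
        P t * entryDeriv (entryDeriv Q) t := by
  have hev : entryDeriv (fun ε => P ε * Q ε) =ᶠ[𝓝 t]
      fun ε => entryDeriv P ε * Q ε + P ε * entryDeriv Q ε := by
    filter_upwards [eventually_all.2 fun i => eventually_all.2 fun j => (hP i j).1,
      eventually_all.2 fun i => eventually_all.2 fun j => (hQ i j).1] with s hPs hQs
    exact entryDeriv_mul hPs hQs
  rw [hev.entryDeriv.eq_of_nhds]
  ext i j
  have h₁ := hasDerivAt_mul_apply (P := entryDeriv P) (Q := Q) (fun i j => (hP i j).2)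
    (fun i j => (hQ i j).1.self_of_nhds) i j
  have h₂ := hasDerivAt_mul_apply (P := P) (Q := entryDeriv Q) (fun i j => (hP i j).1.self_of_nhds)
    (fun i j => (hQ i j).2) i j
  refine (h₁.add h₂).deriv.trans ?_
  simp only [Matrix.add_apply, Matrix.smul_apply, smul_eq_mul]
  ring

lemma Matrix.isDiag_entryDeriv {n : Type*} {F : ℝ → Matrix n n ℝ} {t : ℝ}
    (h : ∀ᶠ ε in 𝓝 t, (F ε).IsDiag) : (entryDeriv F t).IsDiag := by
  intro i j hij
  have h0 : (fun ε => F ε i j) =ᶠ[𝓝 t] fun _ => (0 : ℝ) := h.mono fun ε hε => hε hij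
  exact h0.deriv_eq.trans (deriv_const t 0)

/-- The algebraic step on one diagonal block: `U` is orthogonal, `B` and `L` are the first-order
terms, and `B * U = U * L` is the first-order eigenvalue equation. -/
lemma Matrix.transpose_mul_second_order {m n : Type*} [Fintype m] [DecidableEq m] [Fintype n]
    [DecidableEq n] {U B B₂ L L₂ Y : Matrix m m ℝ} {V : Matrix n n ℝ} {E : Matrix m n ℝ}
    {Z : Matrix n m ℝ} (hU : Uᵀ * U = 1) (hV : Vᵀ * V = 1) (h₁ : B * U = U * L)
    (h₂ : B₂ * U + (2 : ℝ) • (B * Y + E * Z) = (2 : ℝ) • (Y * L) + U * L₂) :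
    Uᵀ * (B₂ * U + (2 : ℝ) • (E * V * (Vᵀ * Z))) =
      (2 : ℝ) • (Uᵀ * Y * L - L * (Uᵀ * Y)) + L₂ := by
  have hV' : V * Vᵀ = 1 := mul_eq_one_comm.1 hV
  have hU' : U * Uᵀ = 1 := mul_eq_one_comm.1 hU
  have hB : Uᵀ * B = L * Uᵀ := by
    calc Uᵀ * B = Uᵀ * (B * U) * Uᵀ := by simp only [Matrix.mul_assoc, hU', Matrix.mul_one]
      _ = L * Uᵀ := by rw [h₁, ← Matrix.mul_assoc, hU, Matrix.one_mul]
  have hEZ : E * V * (Vᵀ * Z) = E * Z := by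
    rw [Matrix.mul_assoc, ← Matrix.mul_assoc V, hV', Matrix.one_mul]
  have h₃ : B₂ * U + (2 : ℝ) • (E * Z) = (2 : ℝ) • (Y * L) + U * L₂ - (2 : ℝ) • (B * Y) := by
    rw [← h₂, smul_add]; abel
  rw [hEZ, h₃, Matrix.mul_sub, Matrix.mul_add, Matrix.mul_smul, Matrix.mul_smul,
    ← Matrix.mul_assoc, ← Matrix.mul_assoc, ← Matrix.mul_assoc, hU, hB, Matrix.one_mul,
    Matrix.mul_assoc L, smul_sub]
  abel

/-- Second-order perturbation identities (A.14)–(A.15) of Appendix A for a twice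
differentiable eigendecomposition `A(ε)X(ε) = X(ε)Λ(ε)`. -/
theorem eigen_perturbation_second_order
    (d e : ℕ) (hd : 0 < d) (he : 0 < e)
    (lam : ℝ) (hlam : lam ≠ 0)
    (A X Λ : ℝ → Matrix (Fin d ⊕ Fin e) (Fin d ⊕ Fin e) ℝ)
    (hAdiff : ∀ i j, (∀ᶠ t in 𝓝 (0 : ℝ), DifferentiableAt ℝ (fun ε => A ε i j) t) ∧
      DifferentiableAt ℝ (deriv fun ε => A ε i j) 0)
    (hXdiff : ∀ i j, (∀ᶠ t in 𝓝 (0 : ℝ), DifferentiableAt ℝ (fun ε => X ε i j) t) ∧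
      DifferentiableAt ℝ (deriv fun ε => X ε i j) 0)
    (hΛdiff : ∀ i j, (∀ᶠ t in 𝓝 (0 : ℝ), DifferentiableAt ℝ (fun ε => Λ ε i j) t) ∧
      DifferentiableAt ℝ (deriv fun ε => Λ ε i j) 0)
    (heig : ∀ᶠ ε in 𝓝 (0 : ℝ), A ε * X ε = X ε * Λ ε)
    (hdiag : ∀ᶠ ε in 𝓝 (0 : ℝ), (Λ ε).IsDiag)
    (hA0 : A 0 = Matrix.fromBlocks (lam • (1 : Matrix (Fin d) (Fin d) ℝ)) 0 0
      (0 : Matrix (Fin e) (Fin e) ℝ))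
    (hΛ0 : Λ 0 = A 0)
    (X₁ : Matrix (Fin d) (Fin d) ℝ) (X₂ : Matrix (Fin e) (Fin e) ℝ)
    (hX0 : X 0 = Matrix.fromBlocks X₁ 0 0 X₂)
    (hX₁ : X₁ᵀ * X₁ = 1) (hX₂ : X₂ᵀ * X₂ = 1)
    (A' X' Λ' A'' Λ'' : Matrix (Fin d ⊕ Fin e) (Fin d ⊕ Fin e) ℝ)
    (hA' : A' = Matrix.of fun i j => deriv (fun ε => A ε i j) 0)
    (hX' : X' = Matrix.of fun i j => deriv (fun ε => X ε i j) 0)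
    (hΛ' : Λ' = Matrix.of fun i j => deriv (fun ε => Λ ε i j) 0)
    (hA'' : A'' = Matrix.of fun i j => iteratedDeriv 2 (fun ε => A ε i j) 0)
    (hΛ'' : Λ'' = Matrix.of fun i j => iteratedDeriv 2 (fun ε => Λ ε i j) 0)
    (C : Matrix (Fin d ⊕ Fin e) (Fin d ⊕ Fin e) ℝ)
    (hC : C = (X 0)ᵀ * X') :
    X₁ᵀ * (A''.toBlocks₁₁ * X₁ + (2 : ℝ) • (A'.toBlocks₁₂ * X₂ * C.toBlocks₂₁)) =
      (2 : ℝ) • (C.toBlocks₁₁ * Λ'.toBlocks₁₁ - Λ'.toBlocks₁₁ * C.toBlocks₁₁) +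
        Λ''.toBlocks₁₁ ∧
    X₂ᵀ * (A''.toBlocks₂₂ * X₂ + (2 : ℝ) • (A'.toBlocks₂₁ * X₁ * C.toBlocks₁₂)) =
      (2 : ℝ) • (C.toBlocks₂₂ * Λ'.toBlocks₂₂ - Λ'.toBlocks₂₂ * C.toBlocks₂₂) +
        Λ''.toBlocks₂₂ := by
  have heig' : (fun ε => A ε * X ε) =ᶠ[𝓝 0] fun ε => X ε * Λ ε := heig
  have first := heig'.entryDeriv.eq_of_nhds
  rw [entryDeriv_mul (fun i j => (hAdiff i j).1.self_of_nhds)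
    (fun i j => (hXdiff i j).1.self_of_nhds), entryDeriv_mul
    (fun i j => (hXdiff i j).1.self_of_nhds) (fun i j => (hΛdiff i j).1.self_of_nhds)] at first
  have second := heig'.entryDeriv.entryDeriv.eq_of_nhds
  rw [entryDeriv_entryDeriv_mul hAdiff hXdiff, entryDeriv_entryDeriv_mul hXdiff hΛdiff] at second
  have hdiag' : Λ'.IsDiag := hΛ' ▸ isDiag_entryDeriv hdiag
  replace hA' : entryDeriv A 0 = A' := hA'.symm
  replace hX' : entryDeriv X 0 = X' := hX'.symm
  replace hΛ' : entryDeriv Λ 0 = Λ' := hΛ'.symm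
  replace hA'' : entryDeriv (entryDeriv A) 0 = A'' := by
    simp only [hA'', iteratedDeriv_succ, iteratedDeriv_zero]; rfl
  replace hΛ'' : entryDeriv (entryDeriv Λ) 0 = Λ'' := by
    simp only [hΛ'', iteratedDeriv_succ, iteratedDeriv_zero]; rfl
  rw [hA', hX', hΛ', hΛ0, hA0, hX0] at first
  rw [hA', hX', hΛ', hA'', hΛ'', hΛ0, hA0, hX0] at second
  generalize entryDeriv (entryDeriv X) 0 = X'' at second
  rw [hX0] at hC
  have h12 : Λ'.toBlocks₁₂ = 0 := by ext i j; exact hdiag' Sum.inl_ne_inr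
  have h21 : Λ'.toBlocks₂₁ = 0 := by ext i j; exact hdiag' Sum.inr_ne_inl
  subst hC
  clear hA' hX' hΛ' hA'' hΛ'' hdiag'
  rw [← fromBlocks_toBlocks A', ← fromBlocks_toBlocks X', ← fromBlocks_toBlocks Λ'] at first second
  rw [← fromBlocks_toBlocks A'', ← fromBlocks_toBlocks X'', ← fromBlocks_toBlocks Λ''] at second
  rw [← fromBlocks_toBlocks X']
  simp only [fromBlocks_transpose, fromBlocks_multiply, fromBlocks_add, fromBlocks_smul, h12, h21,
    transpose_zero, Matrix.zero_mul, Matrix.mul_zero, add_zero, zero_add, fromBlocks_inj,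
    Matrix.smul_mul, Matrix.mul_smul, Matrix.one_mul, Matrix.mul_one, toBlocks_fromBlocks₁₁,
    toBlocks_fromBlocks₁₂, toBlocks_fromBlocks₂₁, toBlocks_fromBlocks₂₂] at first second ⊢
  obtain ⟨f₁, -, -, f₂⟩ := first
  obtain ⟨s₁, -, -, s₂⟩ := second
  rw [add_comm, add_right_inj] at f₁
  rw [add_comm, add_assoc, add_right_inj] at s₁
  refine ⟨transpose_mul_second_order hX₁ hX₂ f₁ s₁, transpose_mul_second_order hX₂ hX₁ f₂ ?_⟩
  rw [← s₂, add_comm (A'.toBlocks₂₂ * _)]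
end
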